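/- arXiv:2011.09915 — 3 statements merged into one kernel-verified Lean document; each statement's English description precedes it below -/
import Mathlib

section
/- Assume the dual-pair setup (B1)–(B5) with (e_j) being (C_u,C_s)-subsymmetric and with (f_j) likewise (C_u,C_s)-subsymmetric (its series converging in the σ(Y,X)-topology). Let T : X → X be a bounded linear operator with δ := inf_j ⟨T e_j, f_j⟩ > 0. Let L be a positive even integer, 0 < κ < 1, and set N = max(L, 1 + ⌈2·C_d²·C_u·C_s³·‖T‖²/(κ²δ²)⌉). Then for every A ⊂ ℕ with |A| = N: (i) the uniform average over all (B,(ε_k)) ∈ Ω_L^A of ⟨T b_B^ε, d_B^ε⟩ is at least (1−κ)·δ·L; in particular (ii) there exist B ⊂ A with |B| = L and signs (ε_k) ∈ E(B) such that ⟨T Σ_{k∈B} ε_k e_k, Σ_{k∈B} ε_k f_k⟩ ≥ (1−κ)·δ·L. -/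
open scoped Classical
open Filter Topology

/-- The series `∑ u j` converges to `x` in the `σ(X,Y)`-topology induced by the
bilinear map `β` (convergence of the pairing of the partial sums against every `y ∈ Y`). -/
def SigmaHasSum {X Y : Type*} [NormedAddCommGroup X] [NormedSpace ℝ X]
    [NormedAddCommGroup Y] [NormedSpace ℝ Y]
    (β : X →ₗ[ℝ] Y →ₗ[ℝ] ℝ) (u : ℕ → X) (x : X) : Prop :=
  ∀ y : Y, Tendsto (fun n => β (∑ j ∈ Finset.range n, u j) y) atTop (𝓝 (β x y))

/-- Axioms (B1)–(B5) for the dual pair `(X, Y, β)` together with the normalized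
sequences `(e j) ⊆ X` and `(f j) ⊆ Y`:
(B1) `β` separates points of `X`; (B2) `β` separates points of `Y`;
(B3) `|β x y| ≤ Cd‖x‖‖y‖`; (B4) `(e j)` and `(f j)` are biorthogonal;
(B5) every `x` has the (unique) representation `x = ∑ β x (f j) • e j`,
the series converging in the `σ(X,Y)`-topology. -/
def DualPair {X Y : Type*} [NormedAddCommGroup X] [NormedSpace ℝ X]
    [NormedAddCommGroup Y] [NormedSpace ℝ Y]
    (β : X →ₗ[ℝ] Y →ₗ[ℝ] ℝ) (Cd : ℝ) (e : ℕ → X) (f : ℕ → Y) : Prop :=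
  (∀ x : X, (∀ y : Y, β x y = 0) → x = 0) ∧
  (∀ y : Y, (∀ x : X, β x y = 0) → y = 0) ∧
  (0 < Cd ∧ ∀ (x : X) (y : Y), |β x y| ≤ Cd * ‖x‖ * ‖y‖) ∧
  (∀ j, ‖e j‖ = 1) ∧ (∀ j, ‖f j‖ = 1) ∧
  (∀ j k, β (e j) (f k) = if j = k then 1 else 0) ∧
  (∀ x : X, SigmaHasSum β (fun j => β x (f j) • e j) x) ∧
  (∀ (x : X) (a : ℕ → ℝ), SigmaHasSum β (fun j => a j • e j) x → ∀ j, a j = β x (f j))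

/-- `(e j)` is `Cu`-unconditional (series converging in the `σ(X,Y)`-topology). -/
def SigmaUncond {X Y : Type*} [NormedAddCommGroup X] [NormedSpace ℝ X]
    [NormedAddCommGroup Y] [NormedSpace ℝ Y]
    (β : X →ₗ[ℝ] Y →ₗ[ℝ] ℝ) (e : ℕ → X) (Cu : ℝ) : Prop :=
  ∀ (a γ : ℕ → ℝ) (x x' : X), BddAbove (Set.range fun k => |γ k|) →
    SigmaHasSum β (fun j => a j • e j) x →
    SigmaHasSum β (fun j => (γ j * a j) • e j) x' →
    ‖x'‖ ≤ Cu * (⨆ k, |γ k|) * ‖x‖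

/-- `(e j)` is `Cs`-spreading (series converging in the `σ(X,Y)`-topology). -/
def SigmaSpreading {X Y : Type*} [NormedAddCommGroup X] [NormedSpace ℝ X]
    [NormedAddCommGroup Y] [NormedSpace ℝ Y]
    (β : X →ₗ[ℝ] Y →ₗ[ℝ] ℝ) (e : ℕ → X) (Cs : ℝ) : Prop :=
  ∀ (a : ℕ → ℝ) (m : ℕ → ℕ), StrictMono m → ∀ (x x' : X),
    SigmaHasSum β (fun j => a j • e j) x →
    SigmaHasSum β (fun j => a j • e (m j)) x' →
    (1 / Cs) * ‖x'‖ ≤ ‖x‖ ∧ ‖x‖ ≤ Cs * ‖x'‖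

/-- `(e j)` is non-`ℓ¹`-splicing, where `P Λ` denotes the basis projection onto the
coordinates in `Λ`: for every infinite `I ⊆ ℕ` and every `θ > 0` there are pairwise
disjoint infinite subsets `Λ j ⊆ I` such that for every sequence `(x j)` in the unit
ball of `X` there are scalars `(a j)` with `∑ |a j| = 1` and `‖∑ a j • P (Λ j) (x j)‖ ≤ θ`. -/
def NonL1Splicing {X : Type*} [NormedAddCommGroup X] [NormedSpace ℝ X]
    (P : Set ℕ → X →L[ℝ] X) : Prop :=
  ∀ I : Set ℕ, I.Infinite → ∀ θ : ℝ, 0 < θ →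
    ∃ Λ : ℕ → Set ℕ,
      (∀ j, (Λ j).Infinite) ∧ (∀ j, Λ j ⊆ I) ∧
      (∀ j k, j ≠ k → Disjoint (Λ j) (Λ k)) ∧
      ∀ x : ℕ → X, (∀ j, ‖x j‖ ≤ 1) →
        ∃ (a : ℕ → ℝ) (z : X),
          HasSum (fun j => |a j|) 1 ∧
          HasSum (fun j => a j • P (Λ j) (x j)) z ∧ ‖z‖ ≤ θ

section BalancedSigns

/-- Pairs `(B, S)` with `S ⊆ B ⊆ A`, `|B| = L` and `2|S| = L`, encoding balanced sign vectors
on `L`-element subsets of `A`. -/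
noncomputable def balancedPairs (A : Finset ℕ) (L : ℕ) : Finset (Finset ℕ × Finset ℕ) :=
  (A.powerset ×ˢ A.powerset).filter (fun q => q.1.card = L ∧ q.2 ⊆ q.1 ∧ 2 * q.2.card = L)

/-- The sign vector encoded by `(B, S)`: `1` on `S`, `-1` on `B \ S` and `0` off `B`. -/
noncomputable def signCoeff (q : Finset ℕ × Finset ℕ) (k : ℕ) : ℝ :=
  if k ∈ q.1 then (if k ∈ q.2 then 1 else -1) else 0

/-- Unnormalized correlation of the signs at `j` and `k` over all balanced pairs. -/
noncomputable def signCorr (A : Finset ℕ) (L j k : ℕ) : ℝ :=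
  ∑ q ∈ balancedPairs A L, signCoeff q j * signCoeff q k

lemma mem_balancedPairs {A : Finset ℕ} {L : ℕ} {q : Finset ℕ × Finset ℕ} :
    q ∈ balancedPairs A L ↔ q.1 ⊆ A ∧ q.1.card = L ∧ q.2 ⊆ q.1 ∧ 2 * q.2.card = L := by
  simp only [balancedPairs, Finset.mem_filter, Finset.mem_product, Finset.mem_powerset]
  exact ⟨fun h => ⟨h.1.1, h.2⟩, fun h => ⟨⟨h.1, h.2.2.1.trans h.1⟩, h.2⟩⟩

lemma balancedPairs_nonempty {A : Finset ℕ} {L : ℕ} (hL : Even L) (hLA : L ≤ A.card) :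
    (balancedPairs A L).Nonempty := by
  obtain ⟨B, hBA, hB⟩ := Finset.exists_subset_card_eq hLA
  obtain ⟨r, hr⟩ := hL
  obtain ⟨S, hSB, hS⟩ := Finset.exists_subset_card_eq (show r ≤ B.card by omega)
  exact ⟨(B, S), mem_balancedPairs.2 ⟨hBA, hB, hSB, by simp only [hS]; omega⟩⟩

lemma sum_smul_signCoeff {V : Type*} [AddCommGroup V] [Module ℝ V] {A : Finset ℕ}
    {q : Finset ℕ × Finset ℕ} (hq : q.1 ⊆ A) (v : ℕ → V) :
    ∑ k ∈ q.1, (if k ∈ q.2 then (1 : ℝ) else -1) • v k = ∑ k ∈ A, signCoeff q k • v k := by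
  rw [← Finset.sum_subset hq]
  · exact Finset.sum_congr rfl fun k hk => by simp [signCoeff, hk]
  · intro k _ hk
    simp [signCoeff, hk]

lemma sum_signCoeff {A : Finset ℕ} {L : ℕ} {q : Finset ℕ × Finset ℕ}
    (hq : q ∈ balancedPairs A L) : ∑ k ∈ A, signCoeff q k = 0 := by
  obtain ⟨hBA, hB, hSB, hS⟩ := mem_balancedPairs.1 hq
  have h := sum_smul_signCoeff hBA (fun _ => (1 : ℝ))
  simp only [smul_eq_mul, mul_one] at h
  have hpt : ∀ k ∈ q.1, (if k ∈ q.2 then (1 : ℝ) else -1) = 2 * (if k ∈ q.2 then 1 else 0) - 1 := by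
    intro k _
    split_ifs <;> norm_num
  rw [← h, Finset.sum_congr rfl hpt, Finset.sum_sub_distrib, ← Finset.mul_sum, Finset.sum_ite_mem,
    Finset.inter_eq_right.2 hSB]
  simp only [Finset.sum_const, nsmul_eq_mul, mul_one]
  rw [hB, ← hS]
  push_cast
  ring

lemma sum_signCoeff_sq {A : Finset ℕ} {L : ℕ} {q : Finset ℕ × Finset ℕ}
    (hq : q ∈ balancedPairs A L) : ∑ k ∈ A, signCoeff q k * signCoeff q k = L := by
  obtain ⟨hBA, hB, -, -⟩ := mem_balancedPairs.1 hq
  have hpt : ∀ k ∈ A, signCoeff q k * signCoeff q k = if k ∈ q.1 then 1 else 0 := by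
    intro k _
    unfold signCoeff
    split_ifs <;> norm_num
  rw [Finset.sum_congr rfl hpt, Finset.sum_ite_mem, Finset.inter_eq_right.2 hBA]
  simp [hB]

lemma map_swap_eq_self {A : Finset ℕ} {i j : ℕ} (hi : i ∈ A) (hj : j ∈ A) :
    A.map (Equiv.swap i j).toEmbedding = A := by
  apply Finset.eq_of_subset_of_card_le _ (by simp)
  intro k hk
  obtain ⟨l, hl, rfl⟩ := Finset.mem_map.1 hk
  simp only [Equiv.coe_toEmbedding]
  rw [Equiv.swap_apply_def]
  split_ifs <;> assumption

lemma signCorr_swap {A : Finset ℕ} {L i i' : ℕ} (hi : i ∈ A) (hi' : i' ∈ A) (j k : ℕ) :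
    signCorr A L (Equiv.swap i i' j) (Equiv.swap i i' k) = signCorr A L j k := by
  set σ := Equiv.swap i i' with hσ
  have hσσ : ∀ B : Finset ℕ, (B.map σ.toEmbedding).map σ.toEmbedding = B := by
    intro B
    ext x
    simp [hσ]
  have hmem : ∀ q ∈ balancedPairs A L,
      (q.1.map σ.toEmbedding, q.2.map σ.toEmbedding) ∈ balancedPairs A L := by
    intro q hq
    obtain ⟨hBA, hB, hSB, hS⟩ := mem_balancedPairs.1 hq
    refine mem_balancedPairs.2 ⟨?_, by simpa using hB, Finset.map_subset_map.2 hSB,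
      by simpa using hS⟩
    rw [← map_swap_eq_self hi hi']
    exact Finset.map_subset_map.2 hBA
  symm
  refine Finset.sum_bij' (fun q _ => (q.1.map σ.toEmbedding, q.2.map σ.toEmbedding))
    (fun q _ => (q.1.map σ.toEmbedding, q.2.map σ.toEmbedding)) hmem hmem ?_ ?_ ?_
  · intro q _
    simp only [hσσ]
  · intro q _
    simp only [hσσ]
  · intro q _
    simp [signCoeff]

lemma sum_signCorr_right (A : Finset ℕ) (L j : ℕ) : ∑ k ∈ A, signCorr A L j k = 0 := by
  unfold signCorr
  rw [Finset.sum_comm]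
  refine Finset.sum_eq_zero fun q hq => ?_
  rw [← Finset.mul_sum, sum_signCoeff hq, mul_zero]

lemma card_mul_signCorr_self {A : Finset ℕ} {L j : ℕ} (hj : j ∈ A) :
    (A.card : ℝ) * signCorr A L j j = L * (balancedPairs A L).card := by
  have hconst : ∀ k ∈ A, signCorr A L k k = signCorr A L j j := by
    intro k hk
    simpa using signCorr_swap (L := L) hj hk j j
  have hsum : ∑ k ∈ A, signCorr A L k k = L * (balancedPairs A L).card := by
    unfold signCorr
    rw [Finset.sum_comm, Finset.sum_congr rfl fun q hq => sum_signCoeff_sq hq]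
    simp [mul_comm]
  rw [← hsum, Finset.sum_congr rfl hconst]
  simp

lemma card_sub_one_mul_signCorr {A : Finset ℕ} {L j k : ℕ} (hj : j ∈ A) (hk : k ∈ A)
    (hjk : j ≠ k) : ((A.card : ℝ) - 1) * signCorr A L j k = -signCorr A L j j := by
  have hconst : ∀ l ∈ A.erase j, signCorr A L j l = signCorr A L j k := by
    intro l hl
    obtain ⟨hlj, hl⟩ := Finset.mem_erase.1 hl
    simpa [Equiv.swap_apply_of_ne_of_ne hjk hlj.symm] using signCorr_swap (L := L) hk hl j k
  have h := sum_signCorr_right A L j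
  rw [← Finset.add_sum_erase A _ hj, Finset.sum_congr rfl hconst, Finset.sum_const,
    Finset.card_erase_of_mem hj, nsmul_eq_mul,
    Nat.cast_sub (Finset.card_pos.2 ⟨j, hj⟩), Nat.cast_one] at h
  linarith

lemma card_mul_sum_signCorr (A : Finset ℕ) (L : ℕ) (a : ℕ → ℕ → ℝ) :
    (A.card : ℝ) * ((A.card : ℝ) - 1) * ∑ j ∈ A, ∑ k ∈ A, signCorr A L j k * a j k =
      L * (balancedPairs A L).card *
        (A.card * ∑ j ∈ A, a j j - ∑ j ∈ A, ∑ k ∈ A, a j k) := by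
  rw [Finset.mul_sum, Finset.mul_sum, ← Finset.sum_sub_distrib, Finset.mul_sum]
  refine Finset.sum_congr rfl fun j hj => ?_
  rw [← Finset.add_sum_erase A _ hj, ← Finset.add_sum_erase A (fun k => a j k) hj]
  have h1 := card_mul_signCorr_self (L := L) hj
  have h2 : ∀ k ∈ A.erase j, ((A.card : ℝ) - 1) * (signCorr A L j k * a j k) =
      -signCorr A L j j * a j k := by
    intro k hk
    obtain ⟨hkj, hk⟩ := Finset.mem_erase.1 hk
    rw [← mul_assoc, card_sub_one_mul_signCorr hj hk hkj.symm]
  have h3 : ((A.card : ℝ) - 1) * ∑ k ∈ A.erase j, signCorr A L j k * a j k =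
      -signCorr A L j j * ∑ k ∈ A.erase j, a j k := by
    rw [Finset.mul_sum, Finset.mul_sum]
    exact Finset.sum_congr rfl h2
  rw [mul_add, mul_assoc (A.card : ℝ) _ (∑ k ∈ A.erase j, signCorr A L j k * a j k), h3, ← h1]
  ring

lemma sum_balancedPairs_bilin {V W : Type*} [AddCommGroup V] [Module ℝ V] [AddCommGroup W]
    [Module ℝ W] (b : V →ₗ[ℝ] W →ₗ[ℝ] ℝ) (A : Finset ℕ) (L : ℕ) (e : ℕ → V) (f : ℕ → W) :
    ∑ q ∈ balancedPairs A L, b (∑ k ∈ q.1, (if k ∈ q.2 then (1 : ℝ) else -1) • e k)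
        (∑ k ∈ q.1, (if k ∈ q.2 then (1 : ℝ) else -1) • f k) =
      ∑ j ∈ A, ∑ k ∈ A, signCorr A L j k * b (e j) (f k) := by
  have h : ∀ q ∈ balancedPairs A L,
      b (∑ k ∈ q.1, (if k ∈ q.2 then (1 : ℝ) else -1) • e k)
        (∑ k ∈ q.1, (if k ∈ q.2 then (1 : ℝ) else -1) • f k) =
      ∑ j ∈ A, ∑ k ∈ A, signCoeff q j * signCoeff q k * b (e j) (f k) := by
    intro q hq
    have hqA := (mem_balancedPairs.1 hq).1
    rw [sum_smul_signCoeff hqA, sum_smul_signCoeff hqA]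
    simp only [map_sum, map_smul, LinearMap.sum_apply, LinearMap.smul_apply, smul_eq_mul,
      Finset.mul_sum]
    rw [Finset.sum_comm]
    refine Finset.sum_congr rfl fun j _ => Finset.sum_congr rfl fun k _ => by ring
  rw [Finset.sum_congr rfl h, Finset.sum_comm]
  refine Finset.sum_congr rfl fun j _ => ?_
  rw [Finset.sum_comm]
  refine Finset.sum_congr rfl fun k _ => ?_
  rw [signCorr, Finset.sum_mul]

end BalancedSigns

section Averaging

lemma sum_range_mod_shift {V : Type*} [AddCommMonoid V] {N r : ℕ} (hr : r ≤ N) (g : ℕ → ℕ → V) :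
    ∑ k ∈ Finset.range N, g k ((k + r) % N) =
      ∑ k ∈ Finset.range (N - r), g k (k + r) + ∑ k ∈ Finset.range r, g (k + (N - r)) k := by
  conv_lhs => rw [show Finset.range N = Finset.range ((N - r) + r) by rw [Nat.sub_add_cancel hr]]
  rw [Finset.sum_range_add]
  congr 1
  · refine Finset.sum_congr rfl fun k hk => ?_
    rw [Nat.mod_eq_of_lt (by have := Finset.mem_range.1 hk; omega)]
  · refine Finset.sum_congr rfl fun k hk => ?_
    have hk := Finset.mem_range.1 hk
    rw [show N - r + k + r = k + N by omega, Nat.add_mod_right, Nat.mod_eq_of_lt (by omega),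
      Nat.add_comm]

lemma sum_range_mod_rotate {V : Type*} [AddCommMonoid V] {N k : ℕ} (hk : k ≤ N) (g : ℕ → V) :
    ∑ r ∈ Finset.range N, g ((k + r) % N) = ∑ r ∈ Finset.range N, g r := by
  have h := sum_range_mod_shift hk (fun _ l => g l)
  simp only [add_comm _ k] at h
  rw [h, add_comm]
  conv_rhs => rw [show Finset.range N = Finset.range (k + (N - k)) by rw [Nat.add_sub_cancel' hk]]
  rw [Finset.sum_range_add]

lemma sum_cyclic_shifts {V : Type*} [AddCommGroup V] [Module ℝ V] (N : ℕ) (c : ℕ → ℝ)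
    (g : ℕ → V) :
    (∑ k ∈ Finset.range N, c k) • ∑ k ∈ Finset.range N, g k =
      ∑ r ∈ Finset.range N, (∑ k ∈ Finset.range (N - r), c k • g (k + r) +
        ∑ k ∈ Finset.range r, c (k + (N - r)) • g k) := by
  have h : ∀ r ∈ Finset.range N, (∑ k ∈ Finset.range (N - r), c k • g (k + r) +
        ∑ k ∈ Finset.range r, c (k + (N - r)) • g k) =
      ∑ k ∈ Finset.range N, c k • g ((k + r) % N) := fun r hr =>
    (sum_range_mod_shift (Finset.mem_range.1 hr).le (fun k l => c k • g l)).symm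
  rw [Finset.sum_congr rfl h, Finset.sum_comm, Finset.sum_smul]
  refine Finset.sum_congr rfl fun k hk => ?_
  rw [← Finset.smul_sum, sum_range_mod_rotate (Finset.mem_range.1 hk).le]

variable {X Y : Type*} [NormedAddCommGroup X] [NormedSpace ℝ X]
    [NormedAddCommGroup Y] [NormedSpace ℝ Y] {β : X →ₗ[ℝ] Y →ₗ[ℝ] ℝ}

lemma sigmaHasSum_of_finite_support {u : ℕ → X} {s : Finset ℕ} (hu : ∀ j ∉ s, u j = 0) :
    SigmaHasSum β u (∑ j ∈ s, u j) := by
  intro y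
  refine tendsto_const_nhds.congr' ?_
  filter_upwards [eventually_ge_atTop (s.sup id + 1)] with n hn
  congr 2
  refine Finset.sum_subset (fun j hj => ?_) fun j _ hj => hu j hj
  have : j ≤ s.sup id := Finset.le_sup (f := id) hj
  exact Finset.mem_range.2 (by omega)

lemma SigmaSpreading.norm_sum_le {e : ℕ → X} {Cs : ℝ} (hs : SigmaSpreading β e Cs) (hCs : 1 ≤ Cs)
    {m m' : ℕ → ℕ} (hm : StrictMono m) (hm' : StrictMono m') (p : ℕ) (a : ℕ → ℝ) :
    ‖∑ k ∈ Finset.range p, a k • e (m k)‖ ≤ Cs ^ 2 * ‖∑ k ∈ Finset.range p, a k • e (m' k)‖ := by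
  have hpos : 0 < Cs := by linarith
  set b : ℕ → ℝ := fun k => if k < p then a k else 0 with hb
  have hsum : ∀ g : ℕ → X, SigmaHasSum β (fun k => b k • g k)
      (∑ k ∈ Finset.range p, a k • g k) := by
    intro g
    have : ∑ k ∈ Finset.range p, a k • g k = ∑ k ∈ Finset.range p, b k • g k :=
      Finset.sum_congr rfl fun k hk => by simp [hb, Finset.mem_range.1 hk]
    rw [this]
    refine sigmaHasSum_of_finite_support fun j hj => ?_
    have : ¬ j < p := by simpa using hj
    simp [hb, this]
  have h1 := (hs b m hm _ _ (hsum e) (hsum fun k => e (m k))).1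
  have h2 := (hs b m' hm' _ _ (hsum e) (hsum fun k => e (m' k))).2
  rw [one_div, inv_mul_le_iff₀ hpos] at h1
  calc _ ≤ _ := h1
    _ ≤ Cs * (Cs * ‖∑ k ∈ Finset.range p, a k • e (m' k)‖) := by gcongr
    _ = _ := by ring

lemma SigmaUncond.norm_sum_le {e : ℕ → X} {Cu : ℝ} (hu : SigmaUncond β e Cu) (hCu : 0 ≤ Cu)
    {x : X} {c : ℕ → ℝ} (hx : SigmaHasSum β (fun j => c j • e j) x) (s : Finset ℕ) :
    ‖∑ j ∈ s, c j • e j‖ ≤ Cu * ‖x‖ := by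
  set γ : ℕ → ℝ := fun j => if j ∈ s then 1 else 0 with hγ
  have hle : ∀ j, |γ j| ≤ 1 := by
    intro j
    simp only [hγ]
    split_ifs <;> simp
  have hsum : SigmaHasSum β (fun j => (γ j * c j) • e j) (∑ j ∈ s, c j • e j) := by
    have : ∑ j ∈ s, c j • e j = ∑ j ∈ s, (γ j * c j) • e j :=
      Finset.sum_congr rfl fun j hj => by simp [hγ, hj]
    rw [this]
    exact sigmaHasSum_of_finite_support fun j hj => by simp [hγ, hj]
  refine (hu c γ x _ ⟨1, Set.forall_mem_range.2 hle⟩ hx hsum).trans ?_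
  gcongr
  exact mul_le_of_le_one_right hCu (ciSup_le hle)

lemma exists_strictMono_image_range_eq (A : Finset ℕ) :
    ∃ m : ℕ → ℕ, StrictMono m ∧ (Finset.range A.card).image m = A := by
  have hmem : ∀ i, A.orderEmbOfFin rfl i ≤ A.sup id := fun i =>
    Finset.le_sup (f := id) (A.orderEmbOfFin_mem rfl i)
  refine ⟨fun k => if h : k < A.card then A.orderEmbOfFin rfl ⟨k, h⟩ else A.sup id + 1 + k,
    fun i j hij => ?_, ?_⟩
  · dsimp only
    split_ifs with hi hj hj
    · exact (A.orderEmbOfFin rfl).strictMono (by simpa using hij)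
    · have := hmem ⟨i, hi⟩
      omega
    · omega
    · omega
  · refine Finset.eq_of_subset_of_card_le (fun x hx => ?_) ?_
    · obtain ⟨k, hk, rfl⟩ := Finset.mem_image.1 hx
      rw [dif_pos (Finset.mem_range.1 hk)]
      exact A.orderEmbOfFin_mem rfl _
    · rw [Finset.card_image_of_injOn, Finset.card_range]
      intro i hi j hj hij
      simpa [Finset.mem_range.1 hi, Finset.mem_range.1 hj] using hij

/-- Averaging a vector over the cyclic shifts of a finite set of coordinates. -/
lemma abs_sum_mul_norm_sum_le {e : ℕ → X} {Cu Cs : ℝ} (hu : SigmaUncond β e Cu) (hCu : 0 ≤ Cu)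
    (hs : SigmaSpreading β e Cs) (hCs : 1 ≤ Cs) {x : X} {c : ℕ → ℝ}
    (hx : SigmaHasSum β (fun j => c j • e j) x) (A : Finset ℕ) :
    |∑ j ∈ A, c j| * ‖∑ j ∈ A, e j‖ ≤ 2 * A.card * (Cs ^ 2 * (Cu * ‖x‖)) := by
  obtain ⟨m, hm, hA⟩ := exists_strictMono_image_range_eq A
  have hshift : ∀ t : ℕ, StrictMono fun k => m (k + t) := fun t i j hij => hm (by omega)
  have hblock : ∀ p s t : ℕ,
      ‖∑ k ∈ Finset.range p, c (m (k + t)) • e (m (k + s))‖ ≤ Cs ^ 2 * (Cu * ‖x‖) := by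
    intro p s t
    refine (hs.norm_sum_le hCs (hshift s) (hshift t) p (fun k => c (m (k + t)))).trans ?_
    gcongr
    have h := hu.norm_sum_le hCu hx ((Finset.range p).image fun k => m (k + t))
    rwa [Finset.sum_image (hshift t).injective.injOn] at h
  rw [← Real.norm_eq_abs, ← norm_smul]
  conv_lhs => rw [← hA]
  rw [Finset.sum_image hm.injective.injOn, Finset.sum_image hm.injective.injOn,
    sum_cyclic_shifts A.card (fun k => c (m k)) (fun k => e (m k))]
  refine (norm_sum_le_of_le (Finset.range A.card)
    (n := fun _ => Cs ^ 2 * (Cu * ‖x‖) + Cs ^ 2 * (Cu * ‖x‖)) fun r _ => ?_).trans_eq ?_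
  · refine (norm_add_le _ _).trans (add_le_add ?_ ?_)
    · simpa using hblock (A.card - r) r 0
    · simpa using hblock r 0 (A.card - r)
  · rw [Finset.sum_const, Finset.card_range, nsmul_eq_mul]
    ring

end Averaging

/-- Under (B1)–(B5) with `(e j)` and `(f j)` both `(Cu,Cs)`-subsymmetric,
let `T : X → X` be bounded with `δ := inf_j ⟨T e_j, f_j⟩ > 0`, let `L` be a positive even
integer, `0 < κ < 1` and `N = max(L, 1 + ⌈2·Cd²·Cu·Cs³·‖T‖²/(κ²δ²)⌉)`.  Then for every
`A ⊆ ℕ` with `|A| = N`: (i) the uniform average over `Ω_L^A` (signs `ε ∈ E(B)` encoded by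
`S = {k ∈ B : ε k = 1}`, `2|S| = L`) of `⟨T b_B^ε, d_B^ε⟩` is at least `(1−κ)·δ·L`; in
particular (ii) there are `B ⊆ A` with `|B| = L` and signs `(ε k) ∈ E(B)` with
`⟨T ∑_{k∈B} ε k e k, ∑_{k∈B} ε k f k⟩ ≥ (1−κ)·δ·L`. -/
theorem subsymmetric_diagonal_average
    {X Y : Type*} [NormedAddCommGroup X] [NormedSpace ℝ X] [CompleteSpace X]
    [NormedAddCommGroup Y] [NormedSpace ℝ Y] [CompleteSpace Y]
    (β : X →ₗ[ℝ] Y →ₗ[ℝ] ℝ) (Cd : ℝ) (e : ℕ → X) (f : ℕ → Y)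
    (hdp : DualPair β Cd e f)
    (Cu Cs : ℝ)
    (hue : SigmaUncond β e Cu) (hse : SigmaSpreading β e Cs)
    (huf : SigmaUncond β.flip f Cu) (hsf : SigmaSpreading β.flip f Cs)
    (T : X →L[ℝ] X) (δ : ℝ) (hδ : 0 < δ)
    (hdiag : ∀ j, δ ≤ β (T (e j)) (f j))
    (L : ℕ) (hL : 0 < L) (hLeven : Even L)
    (κ : ℝ) (hκ0 : 0 < κ) (hκ1 : κ < 1)
    (N : ℕ)
    (hN : N = max L (1 + ⌈2 * Cd ^ 2 * Cu * Cs ^ 3 * ‖T‖ ^ 2 / (κ ^ 2 * δ ^ 2)⌉₊)) :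
    ∀ A : Finset ℕ, A.card = N →
      (((((A.powerset ×ˢ A.powerset).filter
          (fun q => q.1.card = L ∧ q.2 ⊆ q.1 ∧ 2 * q.2.card = L)).card : ℝ))⁻¹ *
        ∑ q ∈ (A.powerset ×ˢ A.powerset).filter
            (fun q => q.1.card = L ∧ q.2 ⊆ q.1 ∧ 2 * q.2.card = L),
          β (T (∑ k ∈ q.1, (if k ∈ q.2 then (1 : ℝ) else -1) • e k))
            (∑ k ∈ q.1, (if k ∈ q.2 then (1 : ℝ) else -1) • f k)
        ≥ (1 - κ) * δ * L) ∧
      (∃ B ⊆ A, B.card = L ∧ ∃ S ⊆ B, 2 * S.card = L ∧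
        β (T (∑ k ∈ B, (if k ∈ S then (1 : ℝ) else -1) • e k))
          (∑ k ∈ B, (if k ∈ S then (1 : ℝ) else -1) • f k)
        ≥ (1 - κ) * δ * L) := by
  obtain ⟨-, -, ⟨hCd, hβ⟩, he, hf, hbi, hrep, -⟩ := hdp
  intro A hA
  have hCd1 : 1 ≤ Cd := by
    simpa [hbi, he, hf] using hβ (e 0) (f 0)
  have he0 : SigmaHasSum β (fun j => (if j = 0 then (1 : ℝ) else 0) • e j) (e 0) := by
    simpa using sigmaHasSum_of_finite_support (β := β) (s := {0})
      (u := fun j => (if j = 0 then (1 : ℝ) else 0) • e j) fun j hj => by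
        simp at hj
        simp [hj]
  have hCs : 1 ≤ Cs := by
    simpa [he] using (hse _ id strictMono_id _ _ he0 he0).2
  have hCu : 1 ≤ Cu := by
    have := hue _ (fun _ => 1) _ _ ⟨1, by simp⟩ he0 (by simpa using he0)
    simpa [he] using this
  have hLN : L ≤ A.card := by rw [hA, hN]; exact le_max_left _ _
  have hL2 : 2 ≤ L := by obtain ⟨r, hr⟩ := hLeven; omega
  have hN2 : (2 : ℝ) ≤ A.card := by exact_mod_cast hL2.trans hLN
  have hδT : δ ≤ Cd * ‖T‖ := by
    calc δ ≤ β (T (e 0)) (f 0) := hdiag 0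
      _ ≤ Cd * ‖T (e 0)‖ * ‖f 0‖ := (le_abs_self _).trans (hβ _ _)
      _ ≤ Cd * ‖T‖ := by
        rw [hf, mul_one]
        gcongr
        simpa [he] using T.le_opNorm (e 0)
  have hNbound : 2 * Cs ^ 2 * Cu * ‖T‖ ≤ κ * δ * ((A.card : ℝ) - 1) := by
    have h1 : 2 * Cd ^ 2 * Cu * Cs ^ 3 * ‖T‖ ^ 2 / (κ ^ 2 * δ ^ 2) ≤ (A.card : ℝ) - 1 := by
      have h : 1 + ⌈2 * Cd ^ 2 * Cu * Cs ^ 3 * ‖T‖ ^ 2 / (κ ^ 2 * δ ^ 2)⌉₊ ≤ A.card := by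
        rw [hA, hN]
        exact le_max_right _ _
      have h' : (1 : ℝ) + (⌈2 * Cd ^ 2 * Cu * Cs ^ 3 * ‖T‖ ^ 2 / (κ ^ 2 * δ ^ 2)⌉₊ : ℝ)
          ≤ A.card := by exact_mod_cast h
      have := Nat.le_ceil (2 * Cd ^ 2 * Cu * Cs ^ 3 * ‖T‖ ^ 2 / (κ ^ 2 * δ ^ 2))
      linarith
    rw [div_le_iff₀ (by positivity)] at h1
    have hκδ : κ * δ ≤ Cd ^ 2 * ‖T‖ := by
      have : κ * δ ≤ δ := mul_le_of_le_one_left hδ.le hκ1.le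
      have : Cd * ‖T‖ ≤ Cd * (Cd * ‖T‖) := le_mul_of_one_le_left (by positivity) hCd1
        |>.trans_eq (by ring)
      nlinarith
    have hCs3 : Cs ^ 2 ≤ Cs ^ 3 := pow_le_pow_right₀ hCs (by norm_num)
    refine le_of_mul_le_mul_right ?_ (mul_pos hκ0 hδ)
    calc 2 * Cs ^ 2 * Cu * ‖T‖ * (κ * δ)
        ≤ 2 * Cs ^ 3 * Cu * ‖T‖ * (Cd ^ 2 * ‖T‖) := by gcongr
      _ = 2 * Cd ^ 2 * Cu * Cs ^ 3 * ‖T‖ ^ 2 := by ring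
      _ ≤ _ := h1
      _ = _ := by ring
  have hEne : 0 < ‖∑ j ∈ A, e j‖ := by
    obtain ⟨k, hk⟩ : A.Nonempty := Finset.card_pos.1 (by omega)
    rw [norm_pos_iff]
    intro h0
    have : β (∑ j ∈ A, e j) (f k) = 1 := by
      simp [map_sum, LinearMap.sum_apply, hbi, hk]
    simp [h0] at this
  have hoff : ∑ j ∈ A, ∑ k ∈ A, β (T (e j)) (f k) ≤ A.card * (2 * Cs ^ 2 * Cu * ‖T‖) := by
    have h := abs_sum_mul_norm_sum_le hue (by linarith) hse hCs (hrep (T (∑ j ∈ A, e j))) A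
    have hT : ∑ k ∈ A, β (T (∑ j ∈ A, e j)) (f k) = ∑ j ∈ A, ∑ k ∈ A, β (T (e j)) (f k) := by
      simp only [map_sum, LinearMap.sum_apply]
      exact Finset.sum_comm
    rw [hT] at h
    refine (le_abs_self _).trans (le_of_mul_le_mul_right (h.trans ?_) hEne)
    calc 2 * (A.card : ℝ) * (Cs ^ 2 * (Cu * ‖T (∑ j ∈ A, e j)‖))
        ≤ 2 * (A.card : ℝ) * (Cs ^ 2 * (Cu * (‖T‖ * ‖∑ j ∈ A, e j‖))) := by
          gcongr
          exact T.le_opNorm _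
      _ = _ := by ring
  have hdiagsum : A.card * δ ≤ ∑ j ∈ A, β (T (e j)) (f j) := by
    simpa using Finset.card_nsmul_le_sum A _ δ fun j _ => hdiag j
  have hne := balancedPairs_nonempty hLeven hLN
  have hcard : (0 : ℝ) < (balancedPairs A L).card := by exact_mod_cast hne.card_pos
  have hsum : (1 - κ) * δ * L * (balancedPairs A L).card ≤
      ∑ q ∈ balancedPairs A L,
        β (T (∑ k ∈ q.1, (if k ∈ q.2 then (1 : ℝ) else -1) • e k))
          (∑ k ∈ q.1, (if k ∈ q.2 then (1 : ℝ) else -1) • f k) := by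
    have hbilin := sum_balancedPairs_bilin (β.comp T.toLinearMap) A L e f
    simp only [LinearMap.comp_apply, ContinuousLinearMap.coe_coe] at hbilin
    rw [hbilin]
    have hpos : (0 : ℝ) < A.card * ((A.card : ℝ) - 1) := by nlinarith
    refine le_of_mul_le_mul_left ?_ hpos
    rw [card_mul_sum_signCorr A L (fun j k => β (T (e j)) (f k))]
    have hkey : (1 - κ) * δ * (A.card * ((A.card : ℝ) - 1)) ≤
        A.card * ∑ j ∈ A, β (T (e j)) (f j) - ∑ j ∈ A, ∑ k ∈ A, β (T (e j)) (f k) := by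
      have h1 := mul_le_mul_of_nonneg_left hdiagsum (Nat.cast_nonneg (α := ℝ) A.card)
      have h2 := mul_le_mul_of_nonneg_left hNbound (Nat.cast_nonneg (α := ℝ) A.card)
      have h3 : 0 ≤ (A.card : ℝ) * δ := by positivity
      linarith
    calc _ = (L : ℝ) * (balancedPairs A L).card *
          ((1 - κ) * δ * (A.card * ((A.card : ℝ) - 1))) := by ring
      _ ≤ _ := by gcongr
  refine ⟨?_, ?_⟩
  · change _ ≤ ((balancedPairs A L).card : ℝ)⁻¹ * ∑ q ∈ balancedPairs A L, _
    rw [le_inv_mul_iff₀ hcard]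
    linarith
  · rw [mul_comm, ← nsmul_eq_mul, ← Finset.sum_const] at hsum
    obtain ⟨q, hq, hle⟩ := Finset.exists_le_of_sum_le hne hsum
    obtain ⟨hBA, hB, hSB, hS⟩ := mem_balancedPairs.1 hq
    exact ⟨q.1, hBA, hB, q.2, hSB, hS, hle⟩
end

section
/- Let (e_j)_{j∈ℕ} be a normalized (C_u,C_s)-subsymmetric Schauder basis of a Banach space X with biorthogonal functionals (e_j*). Then for every n ∈ ℕ, ‖Σ_{j=1}^n e_j‖_X · ‖Σ_{j=1}^n e_j*‖_{X*} ≤ 2·C_u·C_s·n. -/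
open Filter Topology

/-- The series `∑ u j` converges in norm to `x` (ordered partial sums). -/
def NormHasSum {X : Type*} [NormedAddCommGroup X] [NormedSpace ℝ X]
    (u : ℕ → X) (x : X) : Prop :=
  Tendsto (fun n => ∑ j ∈ Finset.range n, u j) atTop (𝓝 x)

/-- `(e j)` is `Cu`-unconditional. -/
def NormUncond {X : Type*} [NormedAddCommGroup X] [NormedSpace ℝ X]
    (e : ℕ → X) (Cu : ℝ) : Prop :=
  ∀ (a γ : ℕ → ℝ) (x x' : X), BddAbove (Set.range fun k => |γ k|) →
    NormHasSum (fun j => a j • e j) x →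
    NormHasSum (fun j => (γ j * a j) • e j) x' →
    ‖x'‖ ≤ Cu * (⨆ k, |γ k|) * ‖x‖

/-- `(e j)` is `Cs`-spreading. -/
def NormSpreading {X : Type*} [NormedAddCommGroup X] [NormedSpace ℝ X]
    (e : ℕ → X) (Cs : ℝ) : Prop :=
  ∀ (a : ℕ → ℝ) (m : ℕ → ℕ), StrictMono m → ∀ (x x' : X),
    NormHasSum (fun j => a j • e j) x →
    NormHasSum (fun j => a j • e (m j)) x' →
    (1 / Cs) * ‖x'‖ ≤ ‖x‖ ∧ ‖x‖ ≤ Cs * ‖x'‖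

theorem normHasSum_of_eq_zero {X : Type*} [NormedAddCommGroup X] [NormedSpace ℝ X]
    {u : ℕ → X} {N : ℕ} (h : ∀ j, N ≤ j → u j = 0) :
    NormHasSum u (∑ j ∈ Finset.range N, u j) := by
  refine tendsto_atTop_of_eventually_const (i₀ := N) fun i hi => ?_
  refine (Finset.sum_subset (Finset.range_mono hi) fun j _ hj => h j ?_).symm
  simpa using hj

/-- Weighted sums over `N` terms of a finitely truncated sequence. -/
theorem normHasSum_ite {X : Type*} [NormedAddCommGroup X] [NormedSpace ℝ X]
    (a : ℕ → ℝ) (v : ℕ → X) (N : ℕ) :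
    NormHasSum (fun j => (if j < N then a j else 0) • v j) (∑ j ∈ Finset.range N, a j • v j) := by
  have h := normHasSum_of_eq_zero (u := fun j => (if j < N then a j else 0) • v j) (N := N)
    fun j hj => by simp [Nat.not_lt.mpr hj]
  convert h using 1
  refine Finset.sum_congr rfl fun j hj => ?_
  simp [Finset.mem_range.mp hj]

theorem NormUncond.nonneg {X : Type*} [NormedAddCommGroup X] [NormedSpace ℝ X]
    {e : ℕ → X} {Cu : ℝ} (hu : NormUncond e Cu) (h0 : ‖e 0‖ = 1) : 0 ≤ Cu := by
  have hb : BddAbove (Set.range fun _ : ℕ => |(1 : ℝ)|) := ⟨1, by rintro _ ⟨k, rfl⟩; simp⟩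
  have h1 := normHasSum_ite (fun _ => 1) e 1
  have h := hu _ (fun _ => 1) _ _ hb h1 (by simpa using h1)
  simp [h0] at h
  linarith

theorem NormSpreading.one_le {X : Type*} [NormedAddCommGroup X] [NormedSpace ℝ X]
    {e : ℕ → X} {Cs : ℝ} (hs : NormSpreading e Cs) (h0 : ‖e 0‖ = 1) : 1 ≤ Cs := by
  have h1 := normHasSum_ite (fun _ => 1) e 1
  have h := (hs _ id strictMono_id _ _ h1 h1).2
  simpa [h0] using h

/-- A finite block of an expansion is controlled by the unconditionality constant. -/
theorem NormUncond.norm_block_le {X : Type*} [NormedAddCommGroup X] [NormedSpace ℝ X]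
    {e : ℕ → X} {Cu : ℝ} (hu : NormUncond e Cu) (hCu : 0 ≤ Cu) {a : ℕ → ℝ} {x : X}
    (hx : NormHasSum (fun j => a j • e j) x) (d N : ℕ) :
    ‖∑ j ∈ Finset.range N, a (j + d) • e (j + d)‖ ≤ Cu * ‖x‖ := by
  set γ : ℕ → ℝ := fun j => if d ≤ j ∧ j < d + N then 1 else 0 with hγ
  have hγ1 : ∀ k, |γ k| ≤ 1 := fun k => by simp only [hγ]; split_ifs <;> simp
  have hsum : NormHasSum (fun j => (γ j * a j) • e j)
      (∑ j ∈ Finset.range N, a (j + d) • e (j + d)) := by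
    have h := normHasSum_of_eq_zero (u := fun j => (γ j * a j) • e j) (N := d + N)
      fun j hj => by simp [hγ, Nat.not_lt.mpr hj]
    convert h using 1
    have hlow : ∑ j ∈ Finset.range d, (γ j * a j) • e j = 0 :=
      Finset.sum_eq_zero fun j hj => by simp [hγ, Nat.not_le.mpr (Finset.mem_range.mp hj)]
    rw [Finset.sum_range_add, hlow, zero_add]
    refine Finset.sum_congr rfl fun j hj => ?_
    simp [hγ, Finset.mem_range.mp hj, add_comm]
  refine (hu a γ x _ ⟨1, by rintro _ ⟨k, rfl⟩; exact hγ1 k⟩ hx hsum).trans ?_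
  gcongr
  exact mul_le_of_le_one_right hCu (ciSup_le hγ1)

theorem NormSpreading.norm_shift_le {X : Type*} [NormedAddCommGroup X] [NormedSpace ℝ X]
    {e : ℕ → X} {Cs : ℝ} (hs : NormSpreading e Cs) (hCs : 0 < Cs) (a : ℕ → ℝ) (d N : ℕ) :
    ‖∑ j ∈ Finset.range N, a j • e (j + d)‖ ≤ Cs * ‖∑ j ∈ Finset.range N, a j • e j‖ ∧
    ‖∑ j ∈ Finset.range N, a j • e j‖ ≤ Cs * ‖∑ j ∈ Finset.range N, a j • e (j + d)‖ := by
  have h := hs _ (fun j => j + d) (fun i j hij => by simpa using hij) _ _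
    (normHasSum_ite a e N) (normHasSum_ite a (fun j => e (j + d)) N)
  refine ⟨?_, h.2⟩
  have h1 := h.1
  rwa [one_div, inv_mul_le_iff₀ hCs] at h1

theorem sum_range_rotate {X : Type*} [AddCommMonoid X] (g : ℕ → ℕ → X) {n k : ℕ} (hk : k < n) :
    ∑ j ∈ Finset.range n, g j ((j + k) % n) =
      ∑ j ∈ Finset.range (n - k), g j (j + k) + ∑ i ∈ Finset.range k, g (i + (n - k)) i := by
  obtain ⟨d, rfl⟩ := Nat.exists_eq_add_of_le hk.le
  rw [add_tsub_cancel_left, add_comm k d, Finset.sum_range_add]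
  congr 1
  · refine Finset.sum_congr rfl fun j hj => ?_
    rw [Nat.mod_eq_of_lt (by have := Finset.mem_range.mp hj; omega)]
  · refine Finset.sum_congr rfl fun j hj => ?_
    rw [show d + j + k = j + (d + k) by omega, Nat.add_mod_right,
      Nat.mod_eq_of_lt (by have := Finset.mem_range.mp hj; omega), add_comm d j]

/-- Averaging over all cyclic rotations of the first `n` coordinates. -/
theorem sum_sum_rotate {X : Type*} [NormedAddCommGroup X] [NormedSpace ℝ X]
    (e : ℕ → X) (a : ℕ → ℝ) (n : ℕ) :
    ∑ k ∈ Finset.range n, ∑ j ∈ Finset.range n, a j • e ((j + k) % n) =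
      (∑ j ∈ Finset.range n, a j) • ∑ j ∈ Finset.range n, e j := by
  rw [Finset.sum_comm, Finset.sum_smul]
  refine Finset.sum_congr rfl fun j hj => ?_
  have hj := Finset.mem_range.mp hj
  rw [← Finset.smul_sum]
  congr 1
  simp_rw [add_comm j]
  rw [sum_range_rotate (fun _ i => e i) hj]
  conv_rhs => rw [← Nat.add_sub_cancel' hj.le, Finset.sum_range_add]
  simp_rw [add_comm j]
  rw [add_comm]

/-- For a normalized `(Cu,Cs)`-subsymmetric Schauder basis `(e j)` of a
Banach space `X` with biorthogonal functionals `(e j)*`, one has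
`‖∑_{j=1}^n e_j‖ · ‖∑_{j=1}^n e_j*‖ ≤ 2·Cu·Cs·n` for every `n`. -/
theorem lambda_mul_mu_le
    {X : Type*} [NormedAddCommGroup X] [NormedSpace ℝ X] [CompleteSpace X]
    (e : ℕ → X) (f : ℕ → X →L[ℝ] ℝ)
    (hnorm : ∀ j, ‖e j‖ = 1)
    (hbi : ∀ j k, f j (e k) = if k = j then 1 else 0)
    (hexp : ∀ x : X, NormHasSum (fun j => f j x • e j) x)
    (Cu Cs : ℝ)
    (hu : NormUncond e Cu) (hs : NormSpreading e Cs) :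
    ∀ n : ℕ,
      ‖∑ j ∈ Finset.range n, e j‖ * ‖∑ j ∈ Finset.range n, f j‖ ≤ 2 * Cu * Cs * n := by
  intro n
  have hCu := hu.nonneg (hnorm 0)
  have hCs : 0 < Cs := zero_lt_one.trans_le (hs.one_le (hnorm 0))
  rw [← norm_norm (∑ j ∈ Finset.range n, e j), ← norm_smul]
  refine ContinuousLinearMap.opNorm_le_bound _ (by positivity) fun x => ?_
  set a : ℕ → ℝ := fun j => f j x with ha
  have hx : NormHasSum (fun j => a j • e j) x := hexp x
  have hrot : ∀ k ∈ Finset.range n,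
      ‖∑ j ∈ Finset.range n, a j • e ((j + k) % n)‖ ≤ 2 * Cu * Cs * ‖x‖ := by
    intro k hk
    rw [sum_range_rotate (fun j i => a j • e i) (Finset.mem_range.mp hk)]
    have h1 := (hs.norm_shift_le hCs a k (n - k)).1
    have h2 := (hs.norm_shift_le hCs (fun i => a (i + (n - k))) (n - k) k).2
    have h3 : ‖∑ j ∈ Finset.range (n - k), a j • e j‖ ≤ Cu * ‖x‖ :=
      hu.norm_block_le hCu hx 0 (n - k)
    have h4 := hu.norm_block_le hCu hx (n - k) k
    calc _ ≤ Cs * (Cu * ‖x‖) + Cs * (Cu * ‖x‖) :=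
          norm_add_le_of_le (h1.trans (by gcongr)) (h2.trans (by gcongr))
      _ = 2 * Cu * Cs * ‖x‖ := by ring
  calc _ = ‖(∑ j ∈ Finset.range n, a j) • ∑ j ∈ Finset.range n, e j‖ := by
        simp [ha, norm_smul, mul_comm]
    _ ≤ ∑ _k ∈ Finset.range n, 2 * Cu * Cs * ‖x‖ := by
        rw [← sum_sum_rotate]
        exact norm_sum_le_of_le _ hrot
    _ = 2 * Cu * Cs * n * ‖x‖ := by
        rw [Finset.sum_const, Finset.card_range, nsmul_eq_mul]
        ring
end

section
/- Let (e_j)_{j∈ℕ} be a normalized C_u-unconditional basis of a Banach space X with biorthogonal functionals (e_j*). Then for every integer n ≥ 2: C_u^{−1} ≤ τ(n) ≤ C_u·min( ‖Σ_{i=1}^n e_i‖_X , ‖Σ_{j=1}^n e_j*‖_{X*} ). -/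
open Filter Topology

/-- `(e j)` is `Cu`-unconditional:
`‖∑_{j∈F} γ_j a_j e_j‖ ≤ Cu · max_{j∈F}|γ_j| · ‖∑_{j∈F} a_j e_j‖` for every finite `F`. -/
def FinsetUncond {X ι : Type*} [NormedAddCommGroup X] [NormedSpace ℝ X]
    (e : ι → X) (Cu : ℝ) : Prop :=
  ∀ (F : Finset ι) (a γ : ι → ℝ),
    ‖∑ j ∈ F, (γ j * a j) • e j‖ ≤ Cu * (⨆ j ∈ F, |γ j|) * ‖∑ j ∈ F, a j • e j‖

/-- `(e j)` is `Cs`-spreading: for every `m`, all scalars and all strictly increasing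
indices `n_1 < … < n_m`,
`(1/Cs)·‖∑_{j<m} a_j e_{n_j}‖ ≤ ‖∑_{j<m} a_j e_j‖ ≤ Cs·‖∑_{j<m} a_j e_{n_j}‖`. -/
def SeqSpreading {X : Type*} [NormedAddCommGroup X] [NormedSpace ℝ X]
    (e : ℕ → X) (Cs : ℝ) : Prop :=
  ∀ (m : ℕ) (a : ℕ → ℝ) (ns : ℕ → ℕ), StrictMono ns →
    (1 / Cs) * ‖∑ j ∈ Finset.range m, a j • e (ns j)‖ ≤
        ‖∑ j ∈ Finset.range m, a j • e j‖ ∧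
    ‖∑ j ∈ Finset.range m, a j • e j‖ ≤ Cs * ‖∑ j ∈ Finset.range m, a j • e (ns j)‖

/-- `τ(n)`: the maximum over all signs `ε i j ∈ {±1}` of
`min( max_{j<n} ‖∑_{i<n, i≠j} ε i j • e i‖ , max_{i<n} ‖∑_{j<n, j≠i} ε i j • f j‖ )`. -/
noncomputable def tauN {X : Type*} [NormedAddCommGroup X] [NormedSpace ℝ X]
    (e : ℕ → X) (f : ℕ → X →L[ℝ] ℝ) (n : ℕ) : ℝ :=
  ⨆ ε : ℕ → ℕ → Bool,
    min (⨆ j ∈ Finset.range n,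
          ‖∑ i ∈ (Finset.range n).erase j, (if ε i j then (1 : ℝ) else -1) • e i‖)
        (⨆ i ∈ Finset.range n,
          ‖∑ j ∈ (Finset.range n).erase i, (if ε i j then (1 : ℝ) else -1) • f j‖)

/-- `ν(n)`: the supremum over all `A ⊆ ℕ` with `|A| = n` of
`min( max_{l∈A} ‖∑_{k∈A∖{l}} e k‖ , max_{k∈A} ‖∑_{l∈A∖{k}} f l‖ )`. -/
noncomputable def nuN {X : Type*} [NormedAddCommGroup X] [NormedSpace ℝ X]
    (e : ℕ → X) (f : ℕ → X →L[ℝ] ℝ) (n : ℕ) : ℝ :=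
  sSup { r : ℝ | ∃ A : Finset ℕ, A.card = n ∧
    r = min (⨆ l ∈ A, ‖∑ k ∈ A.erase l, e k‖) (⨆ k ∈ A, ‖∑ l ∈ A.erase k, f l‖) }

theorem Finset.le_real_biSup {ι : Type*} {F : Finset ι} {g : ι → ℝ} {j : ι} (hj : j ∈ F)
    (hg : ∀ i ∈ F, 0 ≤ g i) : g j ≤ ⨆ i ∈ F, g i := by
  have hbdd : BddAbove (Set.range fun i => ⨆ _ : i ∈ F, g i) := by
    refine ⟨∑ i ∈ F, g i, ?_⟩
    rintro _ ⟨i, rfl⟩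
    exact Real.iSup_le (fun hi => Finset.single_le_sum hg hi) (Finset.sum_nonneg hg)
  refine le_ciSup_of_le hbdd j ?_
  have : Nonempty (j ∈ F) := ⟨hj⟩
  rw [ciSup_const]

theorem Finset.real_biSup_le {ι : Type*} {F : Finset ι} {g : ι → ℝ} {M : ℝ} (hM : 0 ≤ M)
    (hg : ∀ i ∈ F, g i ≤ M) : ⨆ i ∈ F, g i ≤ M :=
  Real.iSup_le (fun i => Real.iSup_le (hg i) hM) hM

section

variable {X ι : Type*} [NormedAddCommGroup X] [NormedSpace ℝ X]

theorem FinsetUncond.one_le [Nonempty ι] {e : ι → X} {Cu : ℝ} (hu : FinsetUncond e Cu)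
    (hnorm : ∀ j, ‖e j‖ = 1) : 1 ≤ Cu := by
  obtain ⟨i⟩ := ‹Nonempty ι›
  have h := hu {i} (fun _ => 1) (fun _ => 1)
  have hsup : ⨆ j ∈ ({i} : Finset ι), |(1 : ℝ)| = 1 := by
    refine le_antisymm (Finset.real_biSup_le zero_le_one fun _ _ => abs_one.le) ?_
    exact abs_one.ge.trans
      (Finset.le_real_biSup (g := fun _ => abs 1) (Finset.mem_singleton_self i)
        fun _ _ => abs_nonneg _)
  rw [hsup] at h
  simpa [hnorm] using h

theorem FinsetUncond.norm_sum_mul_le {e : ι → X} {Cu : ℝ} (hu : FinsetUncond e Cu)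
    (hCu : 0 ≤ Cu) (F : Finset ι) (a γ : ι → ℝ) (hγ : ∀ i, |γ i| ≤ 1) :
    ‖∑ j ∈ F, (γ j * a j) • e j‖ ≤ Cu * ‖∑ j ∈ F, a j • e j‖ := by
  refine (hu F a γ).trans ?_
  gcongr
  exact mul_le_of_le_one_right hCu (Finset.real_biSup_le zero_le_one fun i _ => hγ i)

/-- Restricting a sum of basis vectors to a subset and changing coefficients by factors of modulus
at most one increases its norm by at most the unconditional constant. -/
theorem FinsetUncond.norm_sum_subset_le {e : ι → X} {Cu : ℝ} (hu : FinsetUncond e Cu)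
    (hCu : 0 ≤ Cu) {S F : Finset ι} (hSF : S ⊆ F) (γ : ι → ℝ) (hγ : ∀ i, |γ i| ≤ 1) :
    ‖∑ i ∈ S, γ i • e i‖ ≤ Cu * ‖∑ i ∈ F, e i‖ := by
  classical
  have h := hu.norm_sum_mul_le hCu F (fun _ => 1) (fun i => if i ∈ S then γ i else 0)
    fun i => by split_ifs <;> simp [hγ]
  have hsum : ∑ i ∈ S, γ i • e i = ∑ i ∈ F, (if i ∈ S then γ i else 0) • e i := by
    simp only [ite_smul, zero_smul]
    rw [Finset.sum_ite_mem, Finset.inter_eq_right.mpr hSF]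
  simpa [hsum] using h

/-- The biorthogonal functionals satisfy the same estimate as the basis vectors. -/
theorem FinsetUncond.norm_sum_dual_subset_le {e : ℕ → X} {f : ℕ → X →L[ℝ] ℝ} {Cu : ℝ}
    (hu : FinsetUncond e Cu) (hCu : 0 ≤ Cu)
    (hbi : ∀ j k, f j (e k) = if k = j then 1 else 0)
    (hexp : ∀ x : X, NormHasSum (fun j => f j x • e j) x)
    {S F : Finset ℕ} (hSF : S ⊆ F) (γ : ℕ → ℝ) (hγ : ∀ i, |γ i| ≤ 1) :
    ‖∑ j ∈ S, γ j • f j‖ ≤ Cu * ‖∑ j ∈ F, f j‖ := by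
  refine ContinuousLinearMap.opNorm_le_bound _ (by positivity) fun x => ?_
  have hlim : Tendsto (fun N => Cu * ‖∑ j ∈ F, f j‖ * ‖∑ k ∈ Finset.range N, f k x • e k‖)
      atTop (𝓝 (Cu * ‖∑ j ∈ F, f j‖ * ‖x‖)) := (hexp x).norm.const_mul _
  refine ge_of_tendsto hlim ?_
  obtain ⟨n, hn⟩ := F.exists_nat_subset_range
  filter_upwards [eventually_ge_atTop n] with N hN
  have hFN : F ⊆ Finset.range N := hn.trans (Finset.range_subset_range.mpr hN)
  have heq : (∑ j ∈ S, γ j • f j) x = (∑ j ∈ F, f j)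
      (∑ k ∈ Finset.range N, ((if k ∈ S then γ k else 0) * f k x) • e k) := by
    have hcoord : ∀ j ∈ F,
        f j (∑ k ∈ Finset.range N, ((if k ∈ S then γ k else 0) * f k x) • e k) =
          if j ∈ S then γ j * f j x else 0 := fun j hj => by
      simp only [map_sum, map_smul, hbi, smul_eq_mul, mul_ite, mul_one, mul_zero]
      rw [Finset.sum_ite_eq', if_pos (hFN hj)]
      split_ifs <;> simp
    rw [sum_apply, sum_apply, Finset.sum_congr rfl hcoord, Finset.sum_ite_mem,
      Finset.inter_eq_right.mpr hSF]
    simp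
  rw [heq]
  refine (ContinuousLinearMap.le_opNorm _ _).trans ?_
  rw [mul_comm Cu, mul_assoc]
  gcongr
  exact hu.norm_sum_mul_le hCu _ _ _ fun i => by split_ifs <;> simp [hγ]

end

/-- For a normalized `Cu`-unconditional basis `(e j)` of a Banach space
`X` with biorthogonal functionals `(e j)*`, for every `n ≥ 2`:
`Cu⁻¹ ≤ τ(n) ≤ Cu · min(‖∑_{i=1}^n e_i‖, ‖∑_{j=1}^n e_j*‖)`. -/
theorem tau_bounds_unconditional
    {X : Type*} [NormedAddCommGroup X] [NormedSpace ℝ X] [CompleteSpace X]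
    (e : ℕ → X) (f : ℕ → X →L[ℝ] ℝ)
    (hnorm : ∀ j, ‖e j‖ = 1)
    (hbi : ∀ j k, f j (e k) = if k = j then 1 else 0)
    (hexp : ∀ x : X, NormHasSum (fun j => f j x • e j) x)
    (Cu : ℝ) (hu : FinsetUncond e Cu) :
    ∀ n : ℕ, 2 ≤ n →
      Cu⁻¹ ≤ tauN e f n ∧
      tauN e f n ≤ Cu * min ‖∑ i ∈ Finset.range n, e i‖ ‖∑ j ∈ Finset.range n, f j‖ := by
  intro n hn
  have hCu1 : 1 ≤ Cu := hu.one_le hnorm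
  have hCu : 0 ≤ Cu := zero_le_one.trans hCu1
  have hsign : ∀ b : Bool, |if b then (1 : ℝ) else -1| ≤ 1 := by simp
  have hupper : ∀ ε : ℕ → ℕ → Bool,
      min (⨆ j ∈ Finset.range n,
            ‖∑ i ∈ (Finset.range n).erase j, (if ε i j then (1 : ℝ) else -1) • e i‖)
          (⨆ i ∈ Finset.range n,
            ‖∑ j ∈ (Finset.range n).erase i, (if ε i j then (1 : ℝ) else -1) • f j‖) ≤
        Cu * min ‖∑ i ∈ Finset.range n, e i‖ ‖∑ j ∈ Finset.range n, f j‖ := fun ε => by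
    rw [mul_min_of_nonneg _ _ hCu]
    exact min_le_min
      (Finset.real_biSup_le (by positivity) fun j _ =>
        hu.norm_sum_subset_le hCu (Finset.erase_subset _ _) _ fun i => hsign (ε i j))
      (Finset.real_biSup_le (by positivity) fun i _ =>
        hu.norm_sum_dual_subset_le hCu hbi hexp (Finset.erase_subset _ _) _ fun j =>
          hsign (ε i j))
  refine ⟨?_, ciSup_le hupper⟩
  have h0 : 0 ∈ Finset.range n := Finset.mem_range.mpr (by omega)
  have h1 : 1 ∈ (Finset.range n).erase 0 := by simp; omega
  refine le_ciSup_of_le ⟨_, Set.forall_mem_range.mpr hupper⟩ (fun _ _ => true) (le_min ?_ ?_)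
  · refine le_trans ?_ (Finset.le_real_biSup h0 fun _ _ => norm_nonneg _)
    have h := hu.norm_sum_subset_le hCu (Finset.singleton_subset_iff.mpr h1) (fun _ => 1) (by simp)
    rw [inv_le_iff_one_le_mul₀' (by positivity)]
    simpa [hnorm] using h
  · refine le_trans ?_ (Finset.le_real_biSup h0 fun _ _ => norm_nonneg _)
    refine (inv_le_one_of_one_le₀ hCu1).trans ?_
    have h := (∑ j ∈ (Finset.range n).erase 0, f j).le_opNorm (e 1)
    rw [sum_apply] at h
    simp only [hbi, Finset.sum_ite_eq, if_pos h1, hnorm, norm_one, mul_one] at h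
    simpa using h
end
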